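/- For every SPECTRL specification φ, the abstract-graph skeleton dag φ is a directed acyclic graph: it contains no nonempty directed cycle. -/

import Mathlib

/-- SPECTRL specifications over a predicate set `P`. -/
inductive Spec (P : Type*) : Type _
  | achieve : P → Spec P
  | ensuring : Spec P → P → Spec P
  | seq : Spec P → Spec P → Spec P
  | or : Spec P → Spec P → Spec P

/-- Substitute every predicate `b` by `f b` (the functorial map on `Spec`). -/
def Spec.subst {P Q : Type*} (f : P → Q) : Spec P → Spec Q
  | .achieve b => .achieve (f b)
  | .ensuring φ b => .ensuring (φ.subst f) (f b)
  | .seq φ₁ φ₂ => .seq (φ₁.subst f) (φ₂.subst f)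
  | .or φ₁ φ₂ => .or (φ₁.subst f) (φ₂.subst f)

/-- Vertices of abstract-graph skeletons: an address in the syntax tree
together with a local tag. -/
abbrev SkelV : Type := List Bool × ℕ

/-- An abstract-graph skeleton: a directed graph with a distinguished
initial vertex and a set of final vertices. -/
structure Skeleton where
  verts : Set SkelV
  edges : Set (SkelV × SkelV)
  init : SkelV
  final : Set SkelV

/-- Relabelling used to form disjoint unions of skeletons. -/
def SkelV.pre (b : Bool) : SkelV → SkelV := fun v => (b :: v.1, v.2)

/-- The abstract-graph skeleton of a SPECTRL specification. -/
def Spec.dag {P : Type*} : Spec P → Skeleton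
  | .achieve _ =>
      { verts := {(([] : List Bool), 0), (([] : List Bool), 1)}
        edges := {((([] : List Bool), 0), (([] : List Bool), 1))}
        init := (([] : List Bool), 0)
        final := {(([] : List Bool), 1)} }
  | .ensuring φ _ => φ.dag
  | .seq φ₁ φ₂ =>
      { verts := SkelV.pre false '' φ₁.dag.verts ∪ SkelV.pre true '' φ₂.dag.verts
        edges := (fun e => (SkelV.pre false e.1, SkelV.pre false e.2)) '' φ₁.dag.edges ∪
                 (fun e => (SkelV.pre true e.1, SkelV.pre true e.2)) '' φ₂.dag.edges ∪
                 (fun v => (SkelV.pre false v, SkelV.pre true φ₂.dag.init)) '' φ₁.dag.final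
        init := SkelV.pre false φ₁.dag.init
        final := SkelV.pre true '' φ₂.dag.final }
  | .or φ₁ φ₂ =>
      { verts := insert (([] : List Bool), 2)
          (SkelV.pre false '' φ₁.dag.verts ∪ SkelV.pre true '' φ₂.dag.verts)
        edges := insert ((([] : List Bool), 2), SkelV.pre false φ₁.dag.init)
          (insert ((([] : List Bool), 2), SkelV.pre true φ₂.dag.init)
            ((fun e => (SkelV.pre false e.1, SkelV.pre false e.2)) '' φ₁.dag.edges ∪
             (fun e => (SkelV.pre true e.1, SkelV.pre true e.2)) '' φ₂.dag.edges))
        init := (([] : List Bool), 2)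
        final := SkelV.pre false '' φ₁.dag.final ∪ SkelV.pre true '' φ₂.dag.final }


theorem SkelV.toLex_pre_lt_toLex_pre (b : Bool) {v w : SkelV} (h : toLex v < toLex w) :
    toLex (SkelV.pre b v) < toLex (SkelV.pre b w) := by
  rw [Prod.Lex.toLex_lt_toLex] at h ⊢
  simpa [SkelV.pre, List.cons_lt_cons_iff] using h

theorem SkelV.toLex_pre_false_lt_toLex_pre_true (v w : SkelV) :
    toLex (SkelV.pre false v) < toLex (SkelV.pre true w) := by
  rw [Prod.Lex.toLex_lt_toLex]
  simp [SkelV.pre, List.cons_lt_cons_iff]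

theorem SkelV.toLex_nil_lt_toLex_pre (n : ℕ) (b : Bool) (v : SkelV) :
    toLex (([], n) : SkelV) < toLex (SkelV.pre b v) := by
  rw [Prod.Lex.toLex_lt_toLex]
  simp [SkelV.pre]

/-- Every edge of a skeleton is increasing for the lexicographic order on vertices. -/
theorem Spec.toLex_lt_toLex_of_mem_edges {P : Type*} (φ : Spec P) {v w : SkelV}
    (h : (v, w) ∈ φ.dag.edges) : toLex v < toLex w := by
  induction φ generalizing v w with
  | achieve _ =>
    obtain ⟨rfl, rfl⟩ := Prod.mk.inj h
    simp [Prod.Lex.toLex_lt_toLex]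
  | ensuring φ _ ih => exact ih h
  | seq φ₁ φ₂ ih₁ ih₂ =>
    rcases h with (⟨e, he, h⟩ | ⟨e, he, h⟩) | ⟨u, _, h⟩ <;> obtain ⟨rfl, rfl⟩ := Prod.mk.inj h
    · exact SkelV.toLex_pre_lt_toLex_pre _ (ih₁ he)
    · exact SkelV.toLex_pre_lt_toLex_pre _ (ih₂ he)
    · exact SkelV.toLex_pre_false_lt_toLex_pre_true _ _
  | or φ₁ φ₂ ih₁ ih₂ =>
    rcases h with h | h | ⟨e, he, h⟩ | ⟨e, he, h⟩ <;> obtain ⟨rfl, rfl⟩ := Prod.mk.inj h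
    · exact SkelV.toLex_nil_lt_toLex_pre _ _ _
    · exact SkelV.toLex_nil_lt_toLex_pre _ _ _
    · exact SkelV.toLex_pre_lt_toLex_pre _ (ih₁ he)
    · exact SkelV.toLex_pre_lt_toLex_pre _ (ih₂ he)

/-- The abstract-graph skeleton of every SPECTRL specification is a directed
acyclic graph: it contains no nonempty directed cycle. -/
theorem dag_acyclic {P : Type*} (φ : Spec P) (v : SkelV) :
    ¬ Relation.TransGen (fun a b => (a, b) ∈ φ.dag.edges) v v := by
  intro h
  have hlt : Relation.TransGen (· < ·) (toLex v) (toLex v) :=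
    h.lift toLex fun _ _ => φ.toLex_lt_toLex_of_mem_edges
  rw [Relation.transGen_eq_self] at hlt
  exact lt_irrefl _ hlt
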